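/- arXiv:2604.22381 — 4 statements merged into one kernel-verified Lean document; each statement's English description precedes it below -/
import Mathlib

section
/- Let T be a unital truss with multiplicative identity e. Define t +_e u := [t,e,u] and -_e t := [e,t,e]. Then (T, +_e) is an abelian group with identity e, and the two-sided semi-brace distributivity laws hold: for all s,t,u ∈ T, s(t +_e u) = st -_e s +_e su and (t +_e u)s = ts -_e s +_e us; equivalently, s·[t,e,u] = [st, s, su] and [t,e,u]·s = [ts, s, us]. -/
/-- **Two-sided semi-brace from a unital truss** (Brzeziński).
With `t +_e u := [t,e,u]` and `-_e t := [e,t,e]`, `(T, +_e)` is an abelian group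
with identity `e`, and `s(t +_e u) = st -_e s +_e su`,
`(t +_e u)s = ts -_e s +_e us`; equivalently `s·[t,e,u] = [st,s,su]` and
`[t,e,u]·s = [ts,s,us]`. -/
theorem unital_truss_semibrace {T : Type*}
    (op : T → T → T → T) (mul : T → T → T) (e : T)
    (assoc : ∀ a b c d f : T, op (op a b c) d f = op a b (op c d f))
    (id_right : ∀ a b : T, op a b b = a)
    (id_left : ∀ a b : T, op b b a = a)
    (abelian : ∀ a b c : T, op a b c = op c b a)
    (mul_assoc : ∀ a b c : T, mul (mul a b) c = mul a (mul b c))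
    (left_distrib : ∀ s t₁ t₂ t₃ : T, mul s (op t₁ t₂ t₃) = op (mul s t₁) (mul s t₂) (mul s t₃))
    (right_distrib : ∀ s t₁ t₂ t₃ : T, mul (op t₁ t₂ t₃) s = op (mul t₁ s) (mul t₂ s) (mul t₃ s))
    (one_mul : ∀ t : T, mul e t = t)
    (mul_one : ∀ t : T, mul t e = t) :
    -- `(T, +_e)` is an abelian group with identity `e`:
    (∀ t u : T, op t e u = op u e t) ∧
    (∀ t u v : T, op (op t e u) e v = op t e (op u e v)) ∧
    (∀ t : T, op e e t = t) ∧
    (∀ t : T, op t e e = t) ∧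
    (∀ t : T, op (op e t e) e t = e) ∧
    (∀ t : T, op t e (op e t e) = e) ∧
    -- semi-brace distributivity:  s(t +_e u) = st -_e s +_e su  etc.
    (∀ s t u : T, mul s (op t e u) = op (op (mul s t) e (op e s e)) e (mul s u)) ∧
    (∀ s t u : T, mul (op t e u) s = op (op (mul t s) e (op e s e)) e (mul u s)) ∧
    -- equivalently:
    (∀ s t u : T, mul s (op t e u) = op (mul s t) s (mul s u)) ∧
    (∀ s t u : T, mul (op t e u) s = op (mul t s) s (mul u s)) := by
  have sub_add (a s b : T) : op (op a e (op e s e)) e b = op a s b := by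
    rw [assoc, assoc e s e e b, id_left, ← assoc, id_right]
  have left_law (s t u : T) : mul s (op t e u) = op (mul s t) s (mul s u) := by
    rw [left_distrib, mul_one]
  have right_law (s t u : T) : mul (op t e u) s = op (mul t s) s (mul u s) := by
    rw [right_distrib, one_mul]
  refine ⟨fun t u => abelian t e u, fun t u v => assoc t e u e v, fun t => id_left t e,
    fun t => id_right t e, fun t => ?_, fun t => ?_, fun s t u => ?_, fun s t u => ?_,
    left_law, right_law⟩
  · rw [assoc, id_left, id_right]
  · rw [← assoc, id_right, id_left]
  · rw [sub_add, left_law]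
  · rw [sub_add, right_law]
end

section
/- Let T be a truss with an absorber 0, i.e., an element 0 ∈ T with 0t = 0 = t0 for all t ∈ T. Define t +_0 u := [t,0,u] and -_0 t := [0,t,0]. Then (T, +_0, ·) is a ring: (T, +_0) is an abelian group with zero element 0, the multiplication is associative, and the ring distributivity laws hold: s(t +_0 u) = st +_0 su and (t +_0 u)s = ts +_0 us for all s,t,u ∈ T. -/
/-- **Ring from a truss with an absorber.** If `0` is an absorber of a truss `T`,
then `t +_0 u := [t,0,u]`, `-_0 t := [0,t,0]` and the truss multiplication make
`T` a ring with zero element `0`. -/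
theorem truss_absorber_ring {T : Type*}
    (op : T → T → T → T) (mul : T → T → T) (z : T)
    (assoc : ∀ a b c d f : T, op (op a b c) d f = op a b (op c d f))
    (id_right : ∀ a b : T, op a b b = a)
    (id_left : ∀ a b : T, op b b a = a)
    (abelian : ∀ a b c : T, op a b c = op c b a)
    (mul_assoc : ∀ a b c : T, mul (mul a b) c = mul a (mul b c))
    (left_distrib : ∀ s t₁ t₂ t₃ : T, mul s (op t₁ t₂ t₃) = op (mul s t₁) (mul s t₂) (mul s t₃))
    (right_distrib : ∀ s t₁ t₂ t₃ : T, mul (op t₁ t₂ t₃) s = op (mul t₁ s) (mul t₂ s) (mul t₃ s))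
    (absorb_left : ∀ t : T, mul z t = z)
    (absorb_right : ∀ t : T, mul t z = z) :
    -- `(T, +_0)` is an abelian group with zero element `0`:
    (∀ t u : T, op t z u = op u z t) ∧
    (∀ t u v : T, op (op t z u) z v = op t z (op u z v)) ∧
    (∀ t : T, op z z t = t) ∧
    (∀ t : T, op t z z = t) ∧
    (∀ t : T, op (op z t z) z t = z) ∧
    (∀ t : T, op t z (op z t z) = z) ∧
    -- multiplication is associative:
    (∀ a b c : T, mul (mul a b) c = mul a (mul b c)) ∧
    -- ring distributivity:  s(t +_0 u) = st +_0 su  and  (t +_0 u)s = ts +_0 us: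
    (∀ s t u : T, mul s (op t z u) = op (mul s t) z (mul s u)) ∧
    (∀ s t u : T, mul (op t z u) s = op (mul t s) z (mul u s)) := by
  refine ⟨fun t u => abelian t z u, fun t u v => assoc t z u z v, fun t => id_left t z,
    fun t => id_right t z,
    fun t => ?_, fun t => ?_, mul_assoc, fun s t u => ?_, fun s t u => ?_⟩
  · rw [assoc, id_left, id_right]
  · rw [← assoc, id_right, id_left]
  · rw [left_distrib, absorb_right]
  · rw [right_distrib, absorb_left]
end

section
/- Let X be a Hopf algebra over a commutative ring K with antipode S, and define Δ⁽³⁾ := (id ⊗ S ⊗ id) ∘ (Δ ⊗ id) ∘ Δ : X → X ⊗ X ⊗ X. Then Δ⁽³⁾ satisfies the ternary coassociativity (quantum heap) identity: (id ⊗ id ⊗ Δ⁽³⁾) ∘ Δ⁽³⁾ = (Δ⁽³⁾ ⊗ id ⊗ id) ∘ Δ⁽³⁾ as maps X → X ⊗ X ⊗ X ⊗ X ⊗ X. -/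
open TensorProduct

/-- The ternary comultiplication `Δ⁽³⁾ := (id ⊗ S ⊗ id) ∘ (Δ ⊗ id) ∘ Δ` of a
Hopf algebra (with the middle reassociation `(X ⊗ X) ⊗ X ≃ X ⊗ (X ⊗ X)`). -/
noncomputable def ternaryComul (K : Type*) (X : Type*) [CommRing K] [Ring X]
    [HopfAlgebra K X] : X →ₗ[K] X ⊗[K] (X ⊗[K] X) :=
  TensorProduct.map LinearMap.id
      (TensorProduct.map (HopfAlgebra.antipode (R := K) (A := X)) LinearMap.id)
    ∘ₗ (TensorProduct.assoc K X X X).toLinearMap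
    ∘ₗ TensorProduct.map Coalgebra.comul LinearMap.id
    ∘ₗ Coalgebra.comul

/-- **Ternary coassociativity (quantum heap identity):**
`(id ⊗ id ⊗ Δ⁽³⁾) ∘ Δ⁽³⁾ = (Δ⁽³⁾ ⊗ id ⊗ id) ∘ Δ⁽³⁾` as maps
`X → X ⊗ X ⊗ X ⊗ X ⊗ X` (the right-hand side reassociated into
`X ⊗ (X ⊗ (X ⊗ (X ⊗ X)))`). -/
theorem ternaryComul_coassoc (K : Type*) (X : Type*) [CommRing K] [Ring X]
    [HopfAlgebra K X] (x : X) :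
    TensorProduct.map LinearMap.id (TensorProduct.map LinearMap.id (ternaryComul K X))
        (ternaryComul K X x) =
      TensorProduct.map LinearMap.id (TensorProduct.assoc K X X (X ⊗[K] X)).toLinearMap
        ((TensorProduct.assoc K X (X ⊗[K] X) (X ⊗[K] X))
          (TensorProduct.map (ternaryComul K X) LinearMap.id (ternaryComul K X x))) := by
  refine LinearMap.congr_fun (f := TensorProduct.map LinearMap.id
      (TensorProduct.map LinearMap.id (ternaryComul K X)) ∘ₗ ternaryComul K X)
    (g := TensorProduct.map LinearMap.id (TensorProduct.assoc K X X (X ⊗[K] X)).toLinearMap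
      ∘ₗ (TensorProduct.assoc K X (X ⊗[K] X) (X ⊗[K] X)).toLinearMap
      ∘ₗ TensorProduct.map (ternaryComul K X) LinearMap.id ∘ₗ ternaryComul K X) ?_ x
  simp only [ternaryComul, coassoc_simps]
end

section
/- Let X be a cocommutative Hopf algebra over a commutative ring K, i.e., a Hopf algebra whose comultiplication Δ satisfies τ ∘ Δ = Δ where τ : X ⊗ X → X ⊗ X is the tensor swap. Define Δ⁽³⁾ := (id ⊗ S ⊗ id) ∘ (Δ ⊗ id) ∘ Δ : X → X ⊗ X ⊗ X. Then σ₁₃ ∘ Δ⁽³⁾ = Δ⁽³⁾, where σ₁₃ : X ⊗ X ⊗ X → X ⊗ X ⊗ X is the map exchanging the first and third tensor factors; that is, the associated quantum heap is abelian. -/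
open TensorProduct

/-- The linear map `σ₁₃ : X ⊗ X ⊗ X → X ⊗ X ⊗ X` exchanging the first and third
tensor factors: `x ⊗ y ⊗ z ↦ z ⊗ y ⊗ x`. -/
noncomputable def sigma13 (K : Type*) (X : Type*) [CommRing K] [Ring X] [Module K X]
    [Algebra K X] : X ⊗[K] (X ⊗[K] X) →ₗ[K] X ⊗[K] (X ⊗[K] X) :=
  TensorProduct.map LinearMap.id (TensorProduct.comm K X X).toLinearMap
    ∘ₗ (TensorProduct.assoc K X X X).toLinearMap
    ∘ₗ TensorProduct.map (TensorProduct.comm K X X).toLinearMap LinearMap.id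
    ∘ₗ (TensorProduct.assoc K X X X).symm.toLinearMap
    ∘ₗ TensorProduct.map LinearMap.id (TensorProduct.comm K X X).toLinearMap

lemma sigma13_tmul (K : Type*) (X : Type*) [CommRing K] [Ring X] [Algebra K X] (a b c : X) :
    sigma13 K X (a ⊗ₜ[K] (b ⊗ₜ[K] c)) = c ⊗ₜ[K] (b ⊗ₜ[K] a) := by
  simp [sigma13]

/-- `σ₁₃` commutes with applying a linear map to the middle tensor factor. -/
lemma sigma13_map_middle (K : Type*) (X : Type*) [CommRing K] [Ring X] [Algebra K X]
    (f : X →ₗ[K] X) (y : X ⊗[K] (X ⊗[K] X)) :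
    sigma13 K X (TensorProduct.map LinearMap.id (TensorProduct.map f LinearMap.id) y) =
      TensorProduct.map LinearMap.id (TensorProduct.map f LinearMap.id) (sigma13 K X y) := by
  have h : sigma13 K X ∘ₗ TensorProduct.map LinearMap.id (TensorProduct.map f LinearMap.id) =
      TensorProduct.map LinearMap.id (TensorProduct.map f LinearMap.id) ∘ₗ sigma13 K X := by
    refine TensorProduct.ext_threefold' fun a b c => ?_
    simp [sigma13_tmul]
  exact LinearMap.congr_fun h y

/-- The iterated comultiplication of a cocommutative coalgebra is invariant under `σ₁₃`. -/
lemma sigma13_lTensor_comul_comul (K : Type*) (X : Type*) [CommRing K] [Ring X] [Bialgebra K X]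
    (hcc : (TensorProduct.comm K X X).toLinearMap ∘ₗ (Coalgebra.comul (R := K) (A := X)) =
      Coalgebra.comul) (x : X) :
    sigma13 K X (Coalgebra.comul.lTensor X (Coalgebra.comul (R := K) x)) =
      Coalgebra.comul.lTensor X (Coalgebra.comul (R := K) x) := by
  have hr (z : X ⊗[K] X) : (TensorProduct.comm K X X).toLinearMap.lTensor X
      (Coalgebra.comul.lTensor X z) = Coalgebra.comul.lTensor X z := by
    rw [← LinearMap.lTensor_comp_apply, hcc]
  have hl (z : X ⊗[K] X) : (TensorProduct.comm K X X).toLinearMap.rTensor X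
      (Coalgebra.comul.rTensor X z) = Coalgebra.comul.rTensor X z := by
    rw [← LinearMap.rTensor_comp_apply, hcc]
  change (TensorProduct.comm K X X).toLinearMap.lTensor X (TensorProduct.assoc K X X X
    ((TensorProduct.comm K X X).toLinearMap.rTensor X ((TensorProduct.assoc K X X X).symm
      ((TensorProduct.comm K X X).toLinearMap.lTensor X
        (Coalgebra.comul.lTensor X (Coalgebra.comul (R := K) x)))))) = _
  rw [hr, Coalgebra.coassoc_symm_apply, hl, Coalgebra.coassoc_apply, hr]

/-- **Cocommutative Hopf algebras give abelian quantum heaps:**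
if `τ ∘ Δ = Δ` then `σ₁₃ ∘ Δ⁽³⁾ = Δ⁽³⁾`. -/
theorem sigma13_ternaryComul_of_cocomm (K : Type*) (X : Type*) [CommRing K] [Ring X]
    [HopfAlgebra K X]
    (hcc : (TensorProduct.comm K X X).toLinearMap ∘ₗ (Coalgebra.comul (R := K) (A := X)) =
      Coalgebra.comul) (x : X) :
    sigma13 K X (ternaryComul K X x) = ternaryComul K X x := by
  change sigma13 K X (TensorProduct.map LinearMap.id (TensorProduct.map _ LinearMap.id)
      (TensorProduct.assoc K X X X (Coalgebra.comul.rTensor X (Coalgebra.comul x)))) =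
    TensorProduct.map LinearMap.id (TensorProduct.map _ LinearMap.id)
      (TensorProduct.assoc K X X X (Coalgebra.comul.rTensor X (Coalgebra.comul x)))
  rw [sigma13_map_middle, Coalgebra.coassoc_apply, sigma13_lTensor_comul_comul K X hcc]
end
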